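/- arXiv:1505.06065 — 2 statements merged into one kernel-verified Lean document; each statement's English description precedes it below -/
import Mathlib

section
/- Let A be a complex unital Banach algebra and let (C(t))_{t∈ℝ} be a cosine function in A. If limsup_{t→0} ‖C(t) − 1_A‖ < 2, then limsup_{t→0} ‖C(t) − 1_A‖ = 0. -/
open Filter Topology
open scoped ENNReal NNReal

/-- A cosine function in a unital Banach algebra: `C 0 = 1` and
`C (s+t) + C (s-t) = 2 * C s * C t` for all real `s, t`. -/
def IsCosineFunction {A : Type*} [NormedRing A] (C : ℝ → A) : Prop :=
  C 0 = 1 ∧ ∀ s t : ℝ, C (s + t) + C (s - t) = 2 * C s * C t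

open Polynomial in
/-- The values of a cosine function on `ℕ s` are the Chebyshev polynomials evaluated at `C s`. -/
theorem IsCosineFunction.aeval_chebyshev {A : Type*} [NormedRing A] [NormedAlgebra ℂ A]
    {C : ℝ → A} (hC : IsCosineFunction C) (s : ℝ) (k : ℕ) :
    aeval (C s) (Chebyshev.T ℂ k) = C (k * s) := by
  induction k using Nat.twoStepInduction with
  | zero => simp [hC.1]
  | one => simp
  | more n ih₀ ih₁ =>
    have hT : Chebyshev.T ℂ ((n + 2 : ℕ) : ℤ) =
        2 * Chebyshev.T ℂ ((n + 1 : ℕ) : ℤ) * X - Chebyshev.T ℂ (n : ℤ) := by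
      push_cast
      rw [Chebyshev.T_add_two]
      ring
    have h := hC.2 ((n + 1 : ℕ) * s) s
    rw [hT, map_sub, map_mul, map_mul, aeval_X, ih₀, ih₁, map_ofNat, ← h]
    push_cast
    rw [show ((n : ℝ) + 1) * s + s = (n + 2) * s by ring,
      show ((n : ℝ) + 1) * s - s = n * s by ring, add_sub_cancel_right]

/-- If `0 ≤ z` is small and some multiple `m z` has nonpositive cosine, then an even multiple of `z`
not exceeding `2 m z` has cosine close to `-1`. -/
theorem exists_cos_two_mul_le {z ε : ℝ} (hz : 0 ≤ z) (hzε : z ≤ ε) {m : ℕ}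
    (hm : Real.cos (m * z) ≤ 0) :
    ∃ j ≤ m, Real.cos ((2 * j : ℕ) * z) ≤ 2 * ε ^ 2 - 1 := by
  have hex : ∃ j : ℕ, Real.pi / 2 ≤ j * z := by
    refine ⟨m, le_of_not_gt fun hlt => hm.not_gt (Real.cos_pos_of_mem_Ioo ⟨?_, hlt⟩)⟩
    have : 0 ≤ (m : ℝ) * z := by positivity
    linarith [Real.pi_pos]
  classical
  have hfind := Nat.find_spec hex
  have hle : Nat.find hex ≤ m := by
    refine Nat.find_le (le_of_not_gt fun hlt => hm.not_gt (Real.cos_pos_of_mem_Ioo ⟨?_, hlt⟩))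
    have : 0 ≤ (m : ℝ) * z := by positivity
    linarith [Real.pi_pos]
  obtain ⟨i, hi⟩ : ∃ i, Nat.find hex = i + 1 := by
    refine Nat.exists_eq_succ_of_ne_zero fun h0 => ?_
    rw [h0] at hfind
    simp at hfind
    linarith [Real.pi_pos]
  have hlt := Nat.find_min hex (m := i) (by omega)
  rw [hi] at hfind hle
  push_cast at hfind
  refine ⟨i + 1, hle, ?_⟩
  set e := 2 * ((i + 1) * z) - Real.pi with he
  have he0 : 0 ≤ e := by linarith
  have he1 : e ≤ 2 * ε := by linarith
  have : ((2 * (i + 1) : ℕ) : ℝ) * z = e + Real.pi := by push_cast; rw [he]; ring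
  rw [this, Real.cos_add_pi]
  have := Real.one_sub_sq_div_two_le_cos (x := e)
  nlinarith

/-- For `r < 2` there is `M` such that `cos (M x) > 0` as soon as `1 - cos (k x) ≤ r`
for all `k ≤ 2 M`, uniformly in `x`. -/
theorem exists_cos_mul_pos {r : ℝ} (hr : r < 2) :
    ∃ M : ℕ, 0 < M ∧ ∀ x : ℝ,
      (∀ k ≤ 2 * M, 1 - Real.cos ((k : ℕ) * x) ≤ r) → 0 < Real.cos (M * x) := by
  obtain ⟨ε, hε, hεr⟩ : ∃ ε : ℝ, 0 < ε ∧ 2 * ε ^ 2 < 2 - r := by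
    refine ⟨min 1 ((2 - r) / 4), lt_min one_pos (by linarith), ?_⟩
    have h1 := min_le_left 1 ((2 - r) / 4)
    have h2 := min_le_right 1 ((2 - r) / 4)
    have h3 : 0 < min 1 ((2 - r) / 4) := lt_min one_pos (by linarith)
    nlinarith
  obtain ⟨N, hN⟩ := exists_nat_gt (2 * Real.pi / ε)
  have hNpos : 0 < N := by
    have : 0 < 2 * Real.pi / ε := by positivity
    exact_mod_cast this.trans hN
  refine ⟨N.factorial, N.factorial_pos, fun x hx => ?_⟩
  by_contra! hcos
  obtain ⟨q, hq0, hqN, hq⟩ := Real.exists_nat_abs_mul_sub_round_le (x / (2 * Real.pi)) hNpos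
  obtain ⟨m, hm⟩ := Nat.dvd_factorial hq0 hqN
  set n : ℤ := round (q * (x / (2 * Real.pi)))
  set z : ℝ := q * x - n * (2 * Real.pi) with hz
  have hzε : |z| ≤ ε := by
    have h1 : z = (q * (x / (2 * Real.pi)) - n) * (2 * Real.pi) := by
      rw [hz]; field_simp
    rw [h1, abs_mul, abs_of_pos Real.two_pi_pos]
    calc _ ≤ 1 / ((N : ℝ) + 1) * (2 * Real.pi) := by gcongr
      _ ≤ ε := by
        rw [div_lt_iff₀ hε] at hN
        rw [one_div_mul_eq_div, div_le_iff₀ (by positivity)]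
        linarith
  have hcosz : ∀ k : ℕ, Real.cos (k * |z|) = Real.cos ((k * q : ℕ) * x) := fun k => by
    rw [← abs_of_nonneg (Nat.cast_nonneg (α := ℝ) k), ← abs_mul, Real.cos_abs,
      show (k : ℝ) * z = (k * q : ℕ) * x - (k * n : ℤ) * (2 * Real.pi) by
        rw [hz]; push_cast; ring, Real.cos_sub_int_mul_two_pi]
  obtain ⟨j, hjm, hj⟩ := exists_cos_two_mul_le (abs_nonneg z) hzε (m := m) (by
    rwa [hcosz, mul_comm m q, ← hm])
  rw [hcosz] at hj
  have := hx (2 * j * q) (by rw [hm, mul_assoc, mul_comm q m]; gcongr)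
  linarith

theorem Complex.cos_eq_re_add_im (w : ℂ) :
    Complex.cos w = ⟨Real.cos w.re * Real.cosh w.im, -(Real.sin w.re * Real.sinh w.im)⟩ := by
  rw [Complex.cos_eq, Complex.mk_eq_add_mul_I]
  push_cast
  ring

theorem Complex.norm_one_sub_cos (w : ℂ) :
    ‖1 - Complex.cos w‖ = Real.cosh w.im - Real.cos w.re := by
  have hnn : 0 ≤ Real.cosh w.im - Real.cos w.re := by
    linarith [Real.one_le_cosh w.im, Real.cos_le_one w.re]
  rw [← sq_eq_sq₀ (norm_nonneg _) hnn, ← Complex.normSq_eq_norm_sq, Complex.normSq_apply,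
    Complex.cos_eq_re_add_im, Complex.sub_re, Complex.sub_im, Complex.one_re, Complex.one_im]
  have h1 := Real.sin_sq_add_cos_sq w.re
  have h2 := Real.cosh_sq w.im
  linear_combination (Real.sinh w.im) ^ 2 * h1 + (Real.cos w.re ^ 2 - 1) * h2

/-- An element `1 - x` with `‖x‖ < 1` of a commutative Banach algebra has a square root within
distance `‖x‖` of `1`. -/
theorem exists_sq_eq_one_sub {B : Type*} [NormedCommRing B] [NormedAlgebra ℂ B] [CompleteSpace B]
    {x : B} (hx : ‖x‖ < 1) : ∃ d : B, d ^ 2 = 1 - x ∧ ‖1 - d‖ ≤ ‖x‖ := by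
  let f : B → B := fun y => (2⁻¹ : ℂ) • (x + y ^ 2)
  have hnorm : ∀ y : B, ‖(2⁻¹ : ℂ) • y‖ = ‖y‖ / 2 := fun y => by
    rw [norm_smul]; norm_num; ring
  have hmem : ∀ y : B, y ∈ Metric.closedBall (0 : B) ‖x‖ ↔ ‖y‖ ≤ ‖x‖ := fun y => by simp
  have hmaps : Set.MapsTo f (Metric.closedBall 0 ‖x‖) (Metric.closedBall 0 ‖x‖) := fun y hy => by
    rw [hmem] at hy ⊢
    have h1 : ‖x + y ^ 2‖ ≤ ‖x‖ + ‖y‖ * ‖y‖ :=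
      (norm_add_le _ _).trans (by gcongr; rw [pow_two]; exact norm_mul_le _ _)
    rw [hnorm]
    nlinarith [norm_nonneg x, norm_nonneg y]
  have hcontr : ContractingWith ‖x‖₊ (hmaps.restrict f _ _) := by
    refine ⟨by exact_mod_cast hx, LipschitzWith.of_dist_le_mul fun y z => ?_⟩
    obtain ⟨y, hy⟩ := y
    obtain ⟨z, hz⟩ := z
    rw [hmem] at hy hz
    simp only [Subtype.dist_eq, Set.MapsTo.val_restrict_apply, dist_eq_norm, coe_nnnorm]
    have h1 : f y - f z = (2⁻¹ : ℂ) • ((y + z) * (y - z)) := by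
      simp only [f, ← smul_sub]
      congr 1
      ring
    rw [h1, hnorm]
    have h2 := norm_mul_le (y + z) (y - z)
    have h3 := norm_add_le y z
    nlinarith [norm_nonneg (y - z)]
  obtain ⟨y, hy, hfix, -⟩ := hcontr.exists_fixedPoint' Metric.isClosed_closedBall.isComplete hmaps
    (x := 0) (by simp) (edist_ne_top _ _)
  refine ⟨1 - y, ?_, by simpa using hy⟩
  have h2 : (2 : ℂ) • y = x + y ^ 2 := by
    nth_rewrite 1 [← hfix.eq]
    simp only [f, smul_smul]
    norm_num
  rw [two_smul] at h2
  linear_combination -h2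

theorem AlgHom.norm_apply_le_norm {B : Type*} [NormedRing B] [NormedAlgebra ℂ B] [CompleteSpace B]
    (φ : B →ₐ[ℂ] ℂ) (x : B) : ‖φ x‖ ≤ ‖x‖ := by
  by_contra! h
  have h0 : φ x ≠ 0 := norm_pos_iff.mp ((norm_nonneg x).trans_lt h)
  have hu : IsUnit (1 - (φ x)⁻¹ • x) := by
    refine isUnit_one_sub_of_norm_lt_one ?_
    rw [norm_smul, norm_inv, inv_mul_lt_iff₀ (norm_pos_iff.mpr h0), mul_one]
    exact h
  have := hu.map φ
  simp [h0] at this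

open Polynomial in
/-- Let `M` be as in `exists_cos_mul_pos`. If `T_k(b)` is `r`-close to `1` for all `k ≤ 2 M`, then
`T_M(b)` is at most half as far from `1` as `T_{2M}(b)`. -/
theorem norm_one_sub_aeval_chebyshev_le {B : Type*} [NormedCommRing B] [NormedAlgebra ℂ B]
    [CompleteSpace B] {r : ℝ} (hr : r < 2) {M : ℕ}
    (hM : ∀ x : ℝ, (∀ k ≤ 2 * M, 1 - Real.cos ((k : ℕ) * x) ≤ r) → 0 < Real.cos (M * x))
    (b : B) (hb : ∀ k ≤ 2 * M, ‖1 - aeval b (Chebyshev.T ℂ (k : ℕ))‖ ≤ r) :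
    ‖1 - aeval b (Chebyshev.T ℂ M)‖ ≤ ‖1 - aeval b (Chebyshev.T ℂ (2 * M : ℕ))‖ / 2 := by
  set c := aeval b (Chebyshev.T ℂ M) with hc
  have hdouble : aeval b (Chebyshev.T ℂ (2 * M : ℕ)) = 2 * c ^ 2 - 1 := by
    push_cast
    rw [Chebyshev.T_mul, Chebyshev.T_two, aeval_comp, ← hc]
    simp only [map_sub, map_mul, map_pow, map_one, aeval_X, map_ofNat]
  have hx : ‖1 - c ^ 2‖ = ‖1 - aeval b (Chebyshev.T ℂ (2 * M : ℕ))‖ / 2 := by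
    rw [hdouble, show 1 - (2 * c ^ 2 - 1) = (2 : ℂ) • (1 - c ^ 2) by rw [two_smul]; ring, norm_smul]
    norm_num
  have hlt : ‖1 - c ^ 2‖ < 1 := by
    rw [hx]
    linarith [hb (2 * M) le_rfl]
  obtain ⟨d, hd, hd1⟩ := exists_sq_eq_one_sub hlt
  have hunit : IsUnit (c + d) := by
    by_contra hnu
    obtain ⟨φ, hφ⟩ := WeakDual.CharacterSpace.exists_apply_eq_zero hnu
    let ψ : B →ₐ[ℂ] ℂ := WeakDual.CharacterSpace.toAlgHom φ
    have hψ : ψ c + ψ d = 0 := by rw [← map_add]; exact hφ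
    have hdre : 0 < (ψ d).re := by
      have h1 := (ψ.norm_apply_le_norm (1 - d)).trans_lt (hd1.trans_lt hlt)
      rw [map_sub, map_one] at h1
      have h2 := (Complex.re_le_norm _).trans_lt h1
      simp at h2
      exact h2
    have hcre : 0 < (ψ c).re := by
      obtain ⟨w, hw⟩ := Complex.cos_surjective (ψ b)
      have hT : ∀ k : ℕ, ψ (aeval b (Chebyshev.T ℂ k)) = Complex.cos (k * w) := fun k => by
        rw [← aeval_algHom_apply, ← hw, coe_aeval_eq_eval, Chebyshev.T_complex_cos]
        simp
      have hcos : 0 < Real.cos (M * w.re) := by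
        refine hM w.re fun k hk => ?_
        have h1 := (ψ.norm_apply_le_norm _).trans (hb k hk)
        rw [map_sub, map_one, hT, Complex.norm_one_sub_cos] at h1
        simp only [Complex.mul_re, Complex.natCast_re, Complex.natCast_im, zero_mul, sub_zero] at h1
        linarith [Real.one_le_cosh ((k * w : ℂ).im)]
      rw [hc, hT, Complex.cos_eq_re_add_im]
      exact mul_pos (by simpa using hcos) (Real.cosh_pos _)
    have := congrArg Complex.re hψ
    simp at this
    linarith
  have hcd : c = d := by
    rw [← sub_eq_zero, ← hunit.mul_right_eq_zero]
    linear_combination -hd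
  rw [← hx]
  nth_rewrite 1 [hcd]
  exact hd1

open Polynomial in
theorem IsCosineFunction.norm_one_sub_le_half {A : Type*} [NormedRing A] [NormedAlgebra ℂ A]
    [CompleteSpace A] {C : ℝ → A} (hC : IsCosineFunction C) {r δ : ℝ} (hr : r < 2)
    (hδ : ∀ t, |t| < δ → ‖1 - C t‖ ≤ r) {t : ℝ} (ht : |2 * t| < δ) :
    ‖1 - C t‖ ≤ ‖1 - C (2 * t)‖ / 2 := by
  obtain ⟨M, hM0, hM⟩ := exists_cos_mul_pos hr
  have hM0' : (0 : ℝ) < M := by exact_mod_cast hM0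
  let S := Algebra.elemental ℂ (C (t / M))
  let : NormedCommRing S := { (inferInstance : NormedRing S) with mul_comm := mul_comm }
  let b : S := ⟨C (t / M), Algebra.elemental.self_mem ℂ _⟩
  have hnorm : ∀ k : ℕ, ‖1 - aeval b (Chebyshev.T ℂ k)‖ = ‖1 - C (k * (t / M))‖ := fun k => by
    rw [← hC.aeval_chebyshev]
    change ‖S.val (1 - aeval b (Chebyshev.T ℂ k))‖ = _
    rw [map_sub, map_one, ← aeval_algHom_apply]
    rfl
  have key := norm_one_sub_aeval_chebyshev_le hr hM b fun k hk => by
    rw [hnorm]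
    refine hδ _ (lt_of_le_of_lt ?_ ht)
    have hk' : (k : ℝ) ≤ 2 * M := by exact_mod_cast hk
    rw [abs_mul, abs_div, Nat.abs_cast, Nat.abs_cast, abs_mul, abs_two, mul_div_assoc',
      div_le_iff₀ hM0']
    nlinarith [abs_nonneg t]
  rw [hnorm, hnorm] at key
  convert key using 4
  · field_simp
  · push_cast
    field_simp

theorem IsCosineFunction.tendsto_one {A : Type*} [NormedRing A] [NormedAlgebra ℂ A]
    [CompleteSpace A] {C : ℝ → A} (hC : IsCosineFunction C) {r δ : ℝ} (hr : r < 2) (hδ0 : 0 < δ)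
    (hδ : ∀ t, |t| < δ → ‖1 - C t‖ ≤ r) : Tendsto C (𝓝 0) (𝓝 1) := by
  have hpow : ∀ (n : ℕ) (t : ℝ), |2 ^ n * t| < δ → ‖1 - C t‖ ≤ r / 2 ^ n := by
    intro n
    induction n with
    | zero => simpa using hδ
    | succ n ih =>
      intro t ht
      have h1 := ih (2 * t) (by rwa [← mul_assoc, ← pow_succ])
      have h2 : |2 * t| < δ := by
        refine lt_of_le_of_lt ?_ ht
        rw [pow_succ, mul_assoc, abs_mul (2 ^ n), abs_of_pos (by positivity : (0 : ℝ) < 2 ^ n)]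
        exact le_mul_of_one_le_left (abs_nonneg _) (one_le_pow₀ one_le_two)
      have h3 := hC.norm_one_sub_le_half hr hδ h2
      rw [pow_succ, ← div_div]
      linarith
  rw [Metric.tendsto_nhds]
  intro ε hε
  have hlim : Tendsto (fun n : ℕ => r / 2 ^ n) atTop (𝓝 0) :=
    tendsto_const_nhds.div_atTop (tendsto_pow_atTop_atTop_of_one_lt one_lt_two)
  obtain ⟨n, hn⟩ := (hlim.eventually (gt_mem_nhds hε)).exists
  have hcont : Tendsto (fun t : ℝ => |2 ^ n * t|) (𝓝 0) (𝓝 0) :=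
    Continuous.tendsto' (by fun_prop) _ _ (by simp)
  filter_upwards [hcont.eventually (gt_mem_nhds hδ0)] with t ht
  rw [dist_comm, dist_eq_norm]
  exact (hpow n t ht).trans_lt hn

theorem zero_two_law {A : Type*} [NormedRing A] [NormedAlgebra ℂ A]
    [CompleteSpace A] (C : ℝ → A) (hC : IsCosineFunction C)
    (h : Filter.limsup (fun t : ℝ => (‖C t - 1‖₊ : ℝ≥0∞)) (𝓝[≠] 0) < 2) :
    Filter.limsup (fun t : ℝ => (‖C t - 1‖₊ : ℝ≥0∞)) (𝓝[≠] 0) = 0 := by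
  obtain ⟨r, hLr, hr⟩ := ENNReal.lt_iff_exists_nnreal_btwn.mp h
  have hev := eventually_nhdsWithin_iff.mp (eventually_lt_of_limsup_lt hLr)
  obtain ⟨δ, hδ0, hδ⟩ := Metric.eventually_nhds_iff.mp hev
  have hr2 : (r : ℝ) < 2 := by exact_mod_cast hr
  have hbound : ∀ t, |t| < δ → ‖1 - C t‖ ≤ r := fun t ht => by
    rcases eq_or_ne t 0 with rfl | ht0
    · simp [hC.1]
    · have := hδ (y := t) (by simpa using ht) ht0
      rw [norm_sub_rev]
      exact_mod_cast this.le
  have hlim := (hC.tendsto_one hr2 hδ0 hbound).mono_left (nhdsWithin_le_nhds (s := {0}ᶜ))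
  refine Tendsto.limsup_eq ?_
  have := (hlim.sub_const 1).nnnorm
  rw [sub_self, nnnorm_zero] at this
  rw [← ENNReal.coe_zero]
  exact ENNReal.tendsto_coe.mpr this
end

section
/- Let (c(t))_{t∈ℝ} be a complex-valued cosine function. Then c satisfies exactly one of the following: (i) limsup_{t→0} |c(t) − 1| = +∞, (ii) limsup_{t→0} |c(t) − 1| = 2, (iii) limsup_{t→0} |c(t) − 1| = 0. -/
open Filter Topology
open scoped ENNReal NNReal

/-- A complex-valued cosine function: `c 0 = 1` and
`c (s+t) + c (s-t) = 2 * c s * c t` for all real `s, t`. -/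
def IsScalarCosineFunction (c : ℝ → ℂ) : Prop :=
  c 0 = 1 ∧ ∀ s t : ℝ, c (s + t) + c (s - t) = 2 * c s * c t

lemma Real.exists_nat_cos_mul_le_neg_cos {ψ : ℝ} (h0 : ψ ≠ 0) (hπ : |ψ| ≤ Real.pi) :
    ∃ m : ℕ, m ≠ 0 ∧ Real.cos (m * ψ) ≤ -Real.cos ψ := by
  have hψ : 0 < |ψ| := abs_pos.mpr h0
  refine ⟨⌊Real.pi / |ψ|⌋₊, ?_, ?_⟩
  · rw [← Nat.pos_iff_ne_zero, Nat.floor_pos, le_div_iff₀ hψ, one_mul]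
    exact hπ
  · have h1 : (⌊Real.pi / |ψ|⌋₊ : ℝ) * |ψ| ≤ Real.pi :=
      (le_div_iff₀ hψ).mp (Nat.floor_le (by positivity))
    have h2 : Real.pi < (⌊Real.pi / |ψ|⌋₊ + 1 : ℝ) * |ψ| :=
      (div_lt_iff₀ hψ).mp (Nat.lt_floor_add_one _)
    rw [← Real.cos_abs, abs_mul, Nat.abs_cast, ← Real.cos_abs ψ, ← Real.cos_pi_sub]
    exact Real.cos_le_cos_of_nonneg_of_le_pi (by linarith) h1 (by linarith)

/-- By Dirichlet approximation, the multiples of an angle that is not a multiple of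
`2 * π / N !` come close to `π`. -/
lemma Real.exists_nat_cos_mul_le_of_cos_factorial_mul_ne_one {φ : ℝ} {N : ℕ} (hN : 0 < N)
    (h : Real.cos (N.factorial * φ) ≠ 1) :
    ∃ m : ℕ, m ≠ 0 ∧ Real.cos (m * φ) ≤ -Real.cos (2 * Real.pi / (N + 1)) := by
  obtain ⟨k, hk0, hkN, hk⟩ := Real.exists_nat_abs_mul_sub_round_le (φ / (2 * Real.pi)) hN
  set r := round (k * (φ / (2 * Real.pi)))
  have hπ := Real.pi_pos
  have hψ : k * φ - r * (2 * Real.pi) = (k * (φ / (2 * Real.pi)) - r) * (2 * Real.pi) := by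
    field_simp
  have hN1 : (1 : ℝ) ≤ N := by exact_mod_cast hN
  have hle : |k * φ - r * (2 * Real.pi)| ≤ 2 * Real.pi / (N + 1) := by
    rw [hψ, abs_mul, abs_of_pos (by positivity : 0 < 2 * Real.pi)]
    calc _ ≤ 1 / ((N : ℝ) + 1) * (2 * Real.pi) := by gcongr
      _ = _ := by ring
  have hsmall : 2 * Real.pi / (N + 1) ≤ Real.pi := by
    rw [div_le_iff₀ (by positivity)]
    nlinarith
  have hne : k * φ - r * (2 * Real.pi) ≠ 0 := by
    intro h0
    obtain ⟨d, hd⟩ := Nat.dvd_factorial hk0 hkN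
    apply h
    have : (N.factorial : ℝ) * φ = ((d * r : ℤ) : ℝ) * (2 * Real.pi) := by
      rw [hd]
      push_cast
      linear_combination (d : ℝ) * h0
    rw [this, Real.cos_int_mul_two_pi]
  obtain ⟨m, hm0, hm⟩ := Real.exists_nat_cos_mul_le_neg_cos hne (hle.trans hsmall)
  refine ⟨m * k, mul_ne_zero hm0 hk0.ne', ?_⟩
  have hcos : Real.cos ((m * k : ℕ) * φ) = Real.cos (m * (k * φ - r * (2 * Real.pi))) := by
    rw [← Real.cos_sub_int_mul_two_pi _ (m * r)]
    push_cast
    ring_nf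
  rw [hcos]
  refine hm.trans (neg_le_neg ?_)
  rw [← Real.cos_abs (k * φ - _)]
  exact Real.cos_le_cos_of_nonneg_of_le_pi (abs_nonneg _) hsmall hle

lemma Complex.abs_im_le_norm_cos (z : ℂ) : |z.im| ≤ ‖Complex.cos z‖ := by
  have h : |Real.sinh z.im| ≤ ‖Complex.cos z‖ := by
    have h2 : ‖Complex.exp (z * I)‖ = Real.exp (-z.im) := by simp [Complex.norm_exp]
    have h3 : ‖Complex.exp (-z * I)‖ = Real.exp z.im := by simp [Complex.norm_exp]
    have h4 := abs_norm_sub_norm_le (Complex.exp (-z * I)) (-Complex.exp (z * I))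
    rw [norm_neg, h2, h3, sub_neg_eq_add, add_comm] at h4
    rw [Complex.cos, norm_div, Real.sinh_eq, abs_div]
    simpa using div_le_div_of_nonneg_right h4 zero_le_two
  rw [Real.abs_sinh] at h
  exact (Real.self_le_sinh_iff.mpr (abs_nonneg _)).trans h

/-- A complex number whose Chebyshev orbit is bounded is the cosine of a real angle. -/
lemma Complex.exists_real_cos_eq_of_chebyshev_bounded {w : ℂ} {M : ℝ}
    (h : ∀ n : ℕ, n ≠ 0 → ‖(Polynomial.Chebyshev.T ℂ n).eval w‖ ≤ M) :
    ∃ x : ℝ, w = (Real.cos x : ℂ) := by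
  obtain ⟨z, rfl⟩ := Complex.cos_surjective w
  have hz : z.im = 0 := by
    by_contra hne
    obtain ⟨n, hn⟩ := exists_nat_gt (M / |z.im|)
    have hpos : 0 < |z.im| := abs_pos.mpr hne
    have h1 := h (n + 1) n.succ_ne_zero
    rw [Polynomial.Chebyshev.T_complex_cos] at h1
    have h2 := (Complex.abs_im_le_norm_cos _).trans h1
    have h3 : ((((n + 1 : ℕ) : ℤ) : ℂ) * z).im = (n + 1) * z.im := by
      simp [Complex.mul_im]
    rw [h3, abs_mul, abs_of_pos (by positivity)] at h2
    rw [div_lt_iff₀ hpos] at hn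
    linarith
  refine ⟨z.re, ?_⟩
  rw [Complex.ofReal_cos]
  congr 1
  exact Complex.ext rfl hz

namespace IsScalarCosineFunction

variable {c : ℝ → ℂ}

lemma apply_nat_mul (hc : IsScalarCosineFunction c) (n : ℕ) (t : ℝ) :
    c (n * t) = (Polynomial.Chebyshev.T ℂ n).eval (c t) := by
  induction n using Nat.twoStepInduction with
  | zero => simp [hc.1]
  | one => simp
  | more n ih1 ih2 =>
    have h := hc.2 ((n + 1 : ℕ) * t) t
    have h1 : ((n + 1 : ℕ) : ℝ) * t + t = ((n + 2 : ℕ) : ℝ) * t := by push_cast; ring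
    have h2 : ((n + 1 : ℕ) : ℝ) * t - t = (n : ℝ) * t := by push_cast; ring
    rw [h1, h2, ih1, ih2] at h
    push_cast at h ⊢
    rw [Polynomial.Chebyshev.T_add_two]
    simp only [Polynomial.eval_sub, Polynomial.eval_mul, Polynomial.eval_X,
      Polynomial.eval_ofNat]
    linear_combination h

lemma tendsto_mul_punctured {a : ℝ} (ha : a ≠ 0) :
    Tendsto (fun t : ℝ => a * t) (𝓝[≠] 0) (𝓝[≠] 0) := by
  apply tendsto_nhdsWithin_of_tendsto_nhds_of_eventually_within
  · have : Tendsto (fun t : ℝ => a * t) (𝓝 0) (𝓝 (a * 0)) :=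
      (continuous_const_mul a).tendsto 0
    rw [mul_zero] at this
    exact this.mono_left nhdsWithin_le_nhds
  · filter_upwards [self_mem_nhdsWithin] with t ht
    exact mul_ne_zero ha ht

lemma mapClusterPt_chebyshev (hc : IsScalarCosineFunction c) {w : ℂ}
    (hw : MapClusterPt w (𝓝[≠] 0) c) {n : ℕ} (hn : n ≠ 0) :
    MapClusterPt ((Polynomial.Chebyshev.T ℂ n).eval w) (𝓝[≠] 0) c := by
  have h : MapClusterPt ((Polynomial.Chebyshev.T ℂ n).eval w) (𝓝[≠] 0)
      (c ∘ fun t : ℝ => n * t) := by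
    have : (c ∘ fun t : ℝ => n * t) = (fun z => (Polynomial.Chebyshev.T ℂ n).eval z) ∘ c :=
      funext fun t => hc.apply_nat_mul n t
    rw [this]
    exact hw.continuousAt_comp (Polynomial.continuous _).continuousAt
  exact h.of_comp (tendsto_mul_punctured (by exact_mod_cast hn))

lemma exists_mapClusterPt_chebyshev_eq (hc : IsScalarCosineFunction c) {s : Set ℂ}
    (hs : IsCompact s) (hcs : ∀ᶠ t in 𝓝[≠] 0, c t ∈ s) {w : ℂ}
    (hw : MapClusterPt w (𝓝[≠] 0) c) {n : ℕ} (hn : n ≠ 0) :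
    ∃ v, MapClusterPt v (𝓝[≠] 0) c ∧ (Polynomial.Chebyshev.T ℂ n).eval v = w := by
  obtain ⟨U, hU, hUw⟩ := mapClusterPt_iff_ultrafilter.mp hw
  have hn' : (n : ℝ) ≠ 0 := by exact_mod_cast hn
  have hdiv : Tendsto (fun t : ℝ => (n : ℝ)⁻¹ * t) U (𝓝[≠] 0) :=
    (tendsto_mul_punctured (inv_ne_zero hn')).mono_left hU
  obtain ⟨v, -, hv⟩ := hs.ultrafilter_le_nhds (U.map fun t => c ((n : ℝ)⁻¹ * t))
    (le_principal_iff.mpr (hdiv.eventually hcs))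
  have hv' : Tendsto (fun t => c ((n : ℝ)⁻¹ * t)) U (𝓝 v) := hv
  refine ⟨v, ?_, ?_⟩
  · exact MapClusterPt.of_comp hdiv hv'.mapClusterPt
  · refine tendsto_nhds_unique
      (((Polynomial.continuous (Polynomial.Chebyshev.T ℂ n)).tendsto v).comp hv') (hUw.congr ?_)
    intro t
    rw [Function.comp_apply, ← hc.apply_nat_mul, mul_inv_cancel_left₀ hn']

lemma exists_real_cos_eq (hc : IsScalarCosineFunction c) {s : Set ℂ}
    (hs : IsCompact s) (hcs : ∀ᶠ t in 𝓝[≠] 0, c t ∈ s) {w : ℂ}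
    (hw : MapClusterPt w (𝓝[≠] 0) c) : ∃ x : ℝ, w = (Real.cos x : ℂ) := by
  obtain ⟨M, hM⟩ := hs.isBounded.exists_norm_le
  exact Complex.exists_real_cos_eq_of_chebyshev_bounded fun n hn =>
    hM _ (hs.isClosed.mem_of_mapClusterPt (hc.mapClusterPt_chebyshev hw hn) hcs)

lemma exists_mapClusterPt_cos_le (hc : IsScalarCosineFunction c) {s : Set ℂ}
    (hs : IsCompact s) (hcs : ∀ᶠ t in 𝓝[≠] 0, c t ∈ s) {w : ℂ}
    (hw : MapClusterPt w (𝓝[≠] 0) c) (hw1 : w ≠ 1) {N : ℕ} (hN : 0 < N) :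
    ∃ x : ℝ, MapClusterPt (Real.cos x : ℂ) (𝓝[≠] 0) c ∧
      Real.cos x ≤ -Real.cos (2 * Real.pi / (N + 1)) := by
  obtain ⟨v, hv, rfl⟩ := hc.exists_mapClusterPt_chebyshev_eq hs hcs hw N.factorial_ne_zero
  obtain ⟨φ, rfl⟩ := hc.exists_real_cos_eq hs hcs hv
  have hT (n : ℕ) : (Polynomial.Chebyshev.T ℂ n).eval (Real.cos φ : ℂ)
      = (Real.cos (n * φ) : ℂ) := by
    rw [Complex.ofReal_cos, Polynomial.Chebyshev.T_complex_cos]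
    push_cast
    rfl
  obtain ⟨m, hm0, hm⟩ := Real.exists_nat_cos_mul_le_of_cos_factorial_mul_ne_one (φ := φ) hN
    fun h => hw1 (by rw [hT, h, Complex.ofReal_one])
  exact ⟨m * φ, hT m ▸ hc.mapClusterPt_chebyshev hv hm0, hm⟩

end IsScalarCosineFunction

lemma IsCompact.exists_mapClusterPt_le_of_lt_limsup {α X : Type*} [TopologicalSpace X]
    {l : Filter α} {u : α → X} {s : Set X} (hs : IsCompact s) (hu : ∀ᶠ t in l, u t ∈ s)
    {f : X → ℝ≥0∞} (hf : Continuous f) {a : ℝ≥0∞} (ha : a < limsup (fun t => f (u t)) l) :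
    ∃ w, MapClusterPt w l u ∧ a ≤ f w := by
  have hfreq : ∃ᶠ t in l, u t ∈ s ∩ f ⁻¹' Set.Ici a :=
    ((frequently_lt_of_lt_limsup (by isBoundedDefault) ha).and_eventually hu).mono
      fun t ht => ⟨ht.2, ht.1.le⟩
  obtain ⟨w, hw, hwc⟩ :=
    (hs.inter_right (isClosed_Ici.preimage hf)).exists_mapClusterPt_of_frequently hfreq
  exact ⟨w, hwc, hw.2⟩

lemma nnnorm_real_cos_sub_one (x : ℝ) :
    (‖(Real.cos x : ℂ) - 1‖₊ : ℝ≥0∞) = ENNReal.ofReal (1 - Real.cos x) := by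
  rw [← enorm_eq_nnnorm, ← ofReal_norm, ← Complex.ofReal_one, ← Complex.ofReal_sub,
    Complex.norm_real, Real.norm_eq_abs, abs_sub_comm,
    abs_of_nonneg (sub_nonneg.mpr (Real.cos_le_one x))]

/-- Trichotomy for scalar cosine functions: `limsup_{t→0} |c(t) - 1|` is
either `+∞`, `2`, or `0`; these three alternatives are mutually exclusive,
so exactly one of them holds. -/
theorem scalar_zero_two_law (c : ℝ → ℂ) (hc : IsScalarCosineFunction c) :
    (Filter.limsup (fun t : ℝ => (‖c t - 1‖₊ : ℝ≥0∞)) (𝓝[≠] 0) = ∞ ∧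
        Filter.limsup (fun t : ℝ => (‖c t - 1‖₊ : ℝ≥0∞)) (𝓝[≠] 0) ≠ 2 ∧
        Filter.limsup (fun t : ℝ => (‖c t - 1‖₊ : ℝ≥0∞)) (𝓝[≠] 0) ≠ 0) ∨
      (Filter.limsup (fun t : ℝ => (‖c t - 1‖₊ : ℝ≥0∞)) (𝓝[≠] 0) = 2 ∧
        Filter.limsup (fun t : ℝ => (‖c t - 1‖₊ : ℝ≥0∞)) (𝓝[≠] 0) ≠ ∞ ∧
        Filter.limsup (fun t : ℝ => (‖c t - 1‖₊ : ℝ≥0∞)) (𝓝[≠] 0) ≠ 0) ∨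
      (Filter.limsup (fun t : ℝ => (‖c t - 1‖₊ : ℝ≥0∞)) (𝓝[≠] 0) = 0 ∧
        Filter.limsup (fun t : ℝ => (‖c t - 1‖₊ : ℝ≥0∞)) (𝓝[≠] 0) ≠ ∞ ∧
        Filter.limsup (fun t : ℝ => (‖c t - 1‖₊ : ℝ≥0∞)) (𝓝[≠] 0) ≠ 2) := by
  set L := limsup (fun t : ℝ => (‖c t - 1‖₊ : ℝ≥0∞)) (𝓝[≠] 0) with hL
  have hf : Continuous fun z : ℂ => (‖z - 1‖₊ : ℝ≥0∞) := by fun_prop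
  suffices h : L = ∞ ∨ L = 2 ∨ L = 0 by
    rcases h with h | h | h <;> simp [h]
  refine or_iff_not_imp_left.mpr fun hfin => or_iff_not_imp_right.mpr fun hpos => ?_
  obtain ⟨B, hLB, hB⟩ := exists_between (lt_top_iff_ne_top.mpr hfin)
  lift B to ℝ≥0 using hB.ne
  have hs : IsCompact (Metric.closedBall (1 : ℂ) B) := isCompact_closedBall _ _
  have hcs : ∀ᶠ t in 𝓝[≠] 0, c t ∈ Metric.closedBall (1 : ℂ) B := by
    filter_upwards [eventually_lt_of_limsup_lt hLB] with t ht
    rw [mem_closedBall_iff_norm]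
    exact_mod_cast (ENNReal.coe_lt_coe.mp ht).le
  apply le_antisymm
  · refine le_of_forall_lt fun a ha => ?_
    obtain ⟨b, hab, hb⟩ := exists_between ha
    obtain ⟨w, hw, hbw⟩ := hs.exists_mapClusterPt_le_of_lt_limsup hcs hf hb
    obtain ⟨x, rfl⟩ := hc.exists_real_cos_eq hs hcs hw
    rw [nnnorm_real_cos_sub_one] at hbw
    refine hab.trans_le (hbw.trans ?_)
    rw [← ENNReal.ofReal_ofNat]
    exact ENNReal.ofReal_le_ofReal (by linarith [Real.neg_one_le_cos x])
  · obtain ⟨a, ha0, haL⟩ := exists_between (pos_iff_ne_zero.mpr hpos)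
    obtain ⟨w, hw, haw⟩ := hs.exists_mapClusterPt_le_of_lt_limsup hcs hf haL
    have hw1 : w ≠ 1 := by
      rintro rfl
      simp only [sub_self, nnnorm_zero, ENNReal.coe_zero] at haw
      exact haw.not_gt ha0
    have hbound (N : ℕ) :
        ENNReal.ofReal (1 + Real.cos (2 * Real.pi * (1 / ((N + 1 : ℕ) + 1)))) ≤ L := by
      obtain ⟨x, hx, hxN⟩ := hc.exists_mapClusterPt_cos_le hs hcs hw hw1 N.succ_pos
      refine le_trans ?_ (hx.continuousAt_comp hf.continuousAt).le_limsup
      rw [nnnorm_real_cos_sub_one, mul_one_div]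
      exact ENNReal.ofReal_le_ofReal (by linarith)
    have hcont : Continuous fun y : ℝ => ENNReal.ofReal (1 + Real.cos (2 * Real.pi * y)) :=
      ENNReal.continuous_ofReal.comp (by fun_prop)
    have hlim := (hcont.tendsto 0).comp
      ((tendsto_add_atTop_iff_nat 1).mpr (tendsto_one_div_add_atTop_nhds_zero_nat (𝕜 := ℝ)))
    have h2 : ENNReal.ofReal (1 + Real.cos (2 * Real.pi * 0)) = 2 := by
      norm_num
    rw [h2] at hlim
    exact le_of_tendsto' hlim hbound
end
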